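/- arXiv:2411.13656 — 6 statements merged into one kernel-verified Lean document; each statement's English description precedes it below -/
import Mathlib

section
/- Let τ be a 2-tangle in a graph G with at least 2 edges. Then there exists an edge e of G such that τ extends to a 2-tangle τ' in G − e. -/
open Finset

variable {V : Type} [Fintype V] [DecidableEq V]

/-- `{A, B}` is a separation of the graph `G`: the two sides together cover the vertex set and
no edge of `G` joins `A \ B` to `B \ A`. -/
def IsSep (G : SimpleGraph V) (A B : Finset V) : Prop :=
  A ∪ B = Finset.univ ∧ ∀ a ∈ A \ B, ∀ b ∈ B \ A, ¬ G.Adj a b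

/-- `G[A₁] ∪ G[A₂] ∪ G[A₃] = G` for the induced subgraphs on `A₁`, `A₂`, `A₃`. -/
def CoversG (G : SimpleGraph V) (A₁ A₂ A₃ : Finset V) : Prop :=
  (∀ v : V, v ∈ A₁ ∨ v ∈ A₂ ∨ v ∈ A₃) ∧
    ∀ u v : V, G.Adj u v →
      (u ∈ A₁ ∧ v ∈ A₁) ∨ (u ∈ A₂ ∧ v ∈ A₂) ∨ (u ∈ A₃ ∧ v ∈ A₃)

/-- `τ` is a `k`-tangle in `G`: a set of oriented separations of order `< k` containing exactly
one orientation of every separation of order `< k`, and no three of its elements have small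
sides whose induced subgraphs together cover `G`. -/
def IsTangle (G : SimpleGraph V) (k : ℕ) (τ : Set (Finset V × Finset V)) : Prop :=
  (∀ p ∈ τ, IsSep G p.1 p.2 ∧ (p.1 ∩ p.2).card < k) ∧
    (∀ A B : Finset V, IsSep G A B → (A ∩ B).card < k → ((A, B) ∈ τ ↔ (B, A) ∉ τ)) ∧
    ∀ p₁ ∈ τ, ∀ p₂ ∈ τ, ∀ p₃ ∈ τ, ¬ CoversG G p₁.1 p₂.1 p₃.1

/-- The orientation towards an edge `uv` is a 2-tangle. -/
theorem isTangle_two_of_adj {G : SimpleGraph V} {u v : V} (huv : G.Adj u v) :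
    IsTangle G 2 {p | IsSep G p.1 p.2 ∧ (p.1 ∩ p.2).card < 2 ∧ u ∈ p.2 ∧ v ∈ p.2} := by
  have not_both : ∀ A B : Finset V, (A ∩ B).card < 2 → u ∈ A → v ∈ A → u ∈ B → v ∈ B → False := by
    intro A B hc h1 h2 h3 h4
    exact huv.ne (Finset.card_le_one.1 (Nat.le_of_lt_succ hc) u (by simp [h1, h3]) v
      (by simp [h2, h4]))
  refine ⟨fun p hp => ⟨hp.1, hp.2.1⟩, fun A B hs hc => ?_, ?_⟩
  · constructor
    · rintro ⟨-, -, h1, h2⟩ ⟨-, -, h3, h4⟩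
      exact not_both A B hc h3 h4 h1 h2
    · intro h
      refine ⟨hs, hc, ?_⟩
      have hu : u ∈ A ∪ B := hs.1 ▸ Finset.mem_univ u
      have hv : v ∈ A ∪ B := hs.1 ▸ Finset.mem_univ v
      have h1 := hs.2 u
      have h2 := hs.2 v
      have h' : ¬ (u ∈ A ∧ v ∈ A) := fun hA =>
        h ⟨⟨by rw [Finset.union_comm]; exact hs.1, fun a ha b hb hab => hs.2 b hb a ha hab.symm⟩,
          by rw [Finset.inter_comm]; exact hc, hA⟩
      simp only [Finset.mem_union, Finset.mem_sdiff] at *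
      have h3 := fun hu hv => h1 hu v hv huv
      have h4 := fun hv hu => h2 hv u hu huv.symm
      tauto
  · rintro p₁ ⟨-, c₁, m₁⟩ p₂ ⟨-, c₂, m₂⟩ p₃ ⟨-, c₃, m₃⟩ ⟨-, h⟩
    rcases h u v huv with h | h | h
    · exact not_both _ _ c₁ h.1 h.2 m₁.1 m₁.2
    · exact not_both _ _ c₂ h.1 h.2 m₂.1 m₂.2
    · exact not_both _ _ c₃ h.1 h.2 m₃.1 m₃.2

/-- Every 2-tangle points towards some edge. -/
theorem IsTangle.exists_adj_of_two {G : SimpleGraph V} {τ : Set (Finset V × Finset V)}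
    (hτ : IsTangle G 2 τ) : ∃ u v, G.Adj u v ∧ ∀ p ∈ τ, u ∈ p.2 ∧ v ∈ p.2 := by
  obtain ⟨hsep, hori, hcov⟩ := hτ
  have mem_of : ∀ A B : Finset V, IsSep G A B → (A ∩ B).card < 2 → (B, A) ∉ τ → (A, B) ∈ τ :=
    fun A B hs hc h => (hori A B hs hc).2 h
  have hne : τ.Nonempty := by
    by_cases h : ((Finset.univ : Finset V), (∅ : Finset V)) ∈ τ
    · exact ⟨_, h⟩
    · exact ⟨_, mem_of ∅ Finset.univ ⟨by simp, by simp⟩ (by simp) h⟩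
  obtain ⟨⟨A, B⟩, hAB, hmax⟩ :=
    Set.exists_max_image τ (fun p => p.1.card) τ.toFinite hne
  have no_larger : ∀ A' B' : Finset V, (A', B') ∈ τ → A ⊆ A' → ∀ y ∈ A', y ∈ A := by
    intro A' B' h hsub y hy
    rw [Finset.eq_of_subset_of_card_le hsub (hmax _ h)]
    exact hy
  have cover : ∀ A' B' : Finset V, IsSep G A' B' → CoversG G A' B' B' := by
    intro A' B' h
    have hU : ∀ v, v ∈ A' ∨ v ∈ B' := fun v => Finset.mem_union.1 (h.1 ▸ Finset.mem_univ v)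
    refine ⟨fun v => by grind, fun u v huv => ?_⟩
    have h1 := h.2 u
    have h2 := h.2 v
    simp only [Finset.mem_sdiff] at h1 h2
    have h3 := fun hu hv => h1 hu v hv huv
    have h4 := fun hv hu => h2 hv u hu huv.symm
    have := hU u
    have := hU v
    grind
  obtain ⟨hs, hc⟩ := hsep _ hAB
  dsimp only at hs hc
  have hU : ∀ v, v ∈ A ∨ v ∈ B := fun v => Finset.mem_union.1 (hs.1 ▸ Finset.mem_univ v)
  obtain ⟨b, hb⟩ : ∃ b, b ∉ A := by
    by_contra! h
    exact hcov _ hAB _ hAB _ hAB ⟨fun v => Or.inl (h v), fun u v _ => Or.inl ⟨h u, h v⟩⟩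
  have not_disjoint : ∀ B' : Finset V, (A, B') ∈ τ → A ∩ B' ≠ ∅ := by
    intro B' h h0
    have hs' := (hsep _ h).1
    have hbB : b ∈ B' := by
      have : b ∈ A ∪ B' := hs'.1 ▸ Finset.mem_univ b
      simpa [hb] using this
    refine hb (no_larger (insert b A) B' (mem_of _ _ ⟨?_, ?_⟩ ?_ ?_) (Finset.subset_insert _ _) b
      (Finset.mem_insert_self _ _))
    · rw [Finset.insert_union, hs'.1]; simp
    · intro a ha c hc
      simp only [Finset.mem_sdiff, Finset.mem_insert, not_or] at ha hc
      refine hs'.2 a ?_ c (by simp [hc])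
      rcases ha with ⟨rfl | h1, h2⟩
      · exact absurd hbB h2
      · simp [h1, h2]
    · rw [Finset.insert_inter_of_mem hbB, h0]; simp
    · intro h'
      exact hcov _ h _ h' _ h' (cover A B' hs')
  obtain ⟨x, hx⟩ := Finset.nonempty_iff_ne_empty.2 (not_disjoint B hAB)
  have hx_uniq : ∀ z, z ∈ A → z ∈ B → z = x := fun z h1 h2 =>
    Finset.card_le_one.1 (Nat.le_of_lt_succ hc) z (by simp [h1, h2]) x hx
  have hxA : x ∈ A := (Finset.mem_inter.1 hx).1
  obtain ⟨y, hyA, hxy⟩ : ∃ y, y ∉ A ∧ G.Adj x y := by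
    by_contra! hno
    have h0 : A ∩ B.erase x = ∅ := by
      ext z
      have := hx_uniq z
      simp only [Finset.mem_inter, Finset.mem_erase, Finset.notMem_empty, iff_false]
      grind
    have hs' : IsSep G A (B.erase x) := by
      refine ⟨?_, ?_⟩
      · ext z
        have := hU z
        simp only [Finset.mem_union, Finset.mem_erase, Finset.mem_univ, iff_true]
        by_cases hz : z = x
        · subst hz; exact Or.inl hxA
        · grind
      · intro a ha c hc
        simp only [Finset.mem_sdiff, Finset.mem_erase] at ha hc
        by_cases hax : a = x
        · subst hax; exact hno c hc.2
        · exact hs.2 a (by simp; tauto) c (by simp; tauto)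
    refine not_disjoint _ (mem_of _ _ hs' (by simp [h0]) fun h' => ?_) h0
    exact hcov _ hAB _ h' _ h' (cover _ _ hs')
  refine ⟨x, y, hxy, ?_⟩
  rintro ⟨A', B'⟩ h'
  obtain ⟨hs', hc'⟩ := hsep _ h'
  dsimp only at hs' hc' ⊢
  have hU' : ∀ v, v ∈ A' ∨ v ∈ B' := fun v => Finset.mem_union.1 (hs'.1 ▸ Finset.mem_univ v)
  suffices h : ¬ (x ∈ A' ∧ y ∈ A') by
    have h1 := hs'.2 x
    have h2 := hs'.2 y
    simp only [Finset.mem_sdiff] at h1 h2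
    have h3 := fun hu hv => h1 hu y hv hxy
    have h4 := fun hv hu => h2 hv x hu hxy.symm
    have := hU' x
    have := hU' y
    grind
  rintro ⟨hxA', hyA'⟩
  refine hyA (no_larger (A ∪ A') (B ∩ B') (mem_of _ _ ⟨?_, ?_⟩ ?_ ?_) Finset.subset_union_left y
    (Finset.mem_union_right _ hyA'))
  · ext z
    have := hU z
    have := hU' z
    simp only [Finset.mem_union, Finset.mem_inter, Finset.mem_univ, iff_true]
    grind
  · intro a ha c hc
    have h1 := hs.2 a
    have h2 := hs'.2 a
    simp only [Finset.mem_sdiff, Finset.mem_union, Finset.mem_inter, not_or] at ha hc h1 h2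
    have h3 := fun h => h1 h c
    have h4 := fun h => h2 h c
    have := hU a
    have := hU' a
    grind
  · refine lt_of_le_of_lt (Finset.card_le_card fun z hz => ?_) hc'
    simp only [Finset.mem_union, Finset.mem_inter] at hz ⊢
    obtain ⟨h1 | h1, h2, h3⟩ := hz
    · rw [hx_uniq z h1 h2] at h3 ⊢
      exact ⟨hxA', h3⟩
    · exact ⟨h1, h3⟩
  · intro h''
    refine hcov _ hAB _ h' _ h'' ⟨fun v => ?_, fun u v huv => ?_⟩
    · have := hU v
      have := hU' v
      simp only [Finset.mem_inter]
      grind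
    · have h1 := (cover A B hs).2 u v huv
      have h2 := (cover A' B' hs').2 u v huv
      simp only [Finset.mem_inter]
      grind

/-- For every 2-tangle `τ` in a graph `G` with at least 2 edges, there is an edge `e` of `G`
such that `τ` extends to a 2-tangle in `G - e`. -/
theorem stmt6 (G : SimpleGraph V) (hG : 2 ≤ G.edgeSet.ncard)
    (τ : Set (Finset V × Finset V)) (hτ : IsTangle G 2 τ) :
    ∃ e ∈ G.edgeSet, ∃ τ' : Set (Finset V × Finset V),
      IsTangle (G.deleteEdges {e}) 2 τ' ∧ τ ⊆ τ' := by
  obtain ⟨u, v, huv, hpt⟩ := hτ.exists_adj_of_two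
  obtain ⟨e, he, hne⟩ := Set.exists_ne_of_one_lt_ncard hG s(u, v)
  have huv' : (G.deleteEdges {e}).Adj u v := by
    rw [SimpleGraph.deleteEdges_adj]
    exact ⟨huv, fun h => hne (Set.mem_singleton_iff.1 h).symm⟩
  refine ⟨e, he, _, isTangle_two_of_adj huv', fun p hp => ?_⟩
  obtain ⟨⟨h1, h2⟩, h3⟩ := hτ.1 p hp
  exact ⟨⟨h1, fun a ha b hb hab => h2 a ha b hb (SimpleGraph.deleteEdges_le _ hab)⟩, h3,
    hpt p hp⟩
end

section
/- Let k ≥ 1 be an integer and let τ be a k-tangle in a graph G. Then there exists a unique component G' of G such that τ extends to a k-tangle τ' in G', and moreover τ' is the unique k-tangle in G' to which τ extends. -/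
open Finset

variable {V : Type} [Fintype V] [DecidableEq V]

/-- `s` is the vertex set of a (connected) component of `G`. -/
def IsComponentSet (G : SimpleGraph V) (s : Finset V) : Prop :=
  ∃ c : G.ConnectedComponent, (s : Set V) = c.supp

/-- The tangle `τ` in `G` extends to the set `τ'` of oriented separations of the component
with vertex set `s`: for every `(A, B) ∈ τ` we have `(A ∩ V(G'), B ∩ V(G')) ∈ τ'`. -/
def ExtendsToComponent (τ : Set (Finset V × Finset V)) (s : Finset V)
    (τ' : Set (Finset {x : V // x ∈ s} × Finset {x : V // x ∈ s})) : Prop :=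
  ∀ p ∈ τ, (p.1.subtype (· ∈ s), p.2.subtype (· ∈ s)) ∈ τ'

set_option linter.unusedSectionVars false

theorem IsSep.symm {G : SimpleGraph V} {A B : Finset V} (h : IsSep G A B) : IsSep G B A :=
  ⟨by rw [Finset.union_comm, h.1], fun a ha b hb hab => h.2 b hb a ha hab.symm⟩

theorem IsSep.mem_or_mem {G : SimpleGraph V} {A B : Finset V} (h : IsSep G A B) (v : V) :
    v ∈ A ∨ v ∈ B := by
  rw [← Finset.mem_union, h.1]
  exact Finset.mem_univ v

theorem IsSep.adj_mem {G : SimpleGraph V} {A B : Finset V} (h : IsSep G A B) {u v : V}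
    (huv : G.Adj u v) : (u ∈ A ∧ v ∈ A) ∨ (u ∈ B ∧ v ∈ B) := by
  have h₁ := h.2 u
  have h₂ := h.2 v
  have h₃ := h.mem_or_mem u
  have h₄ := h.mem_or_mem v
  have h₅ := huv.symm
  simp only [Finset.mem_sdiff] at h₁ h₂
  grind

theorem isSep_of_forall_adj {G : SimpleGraph V} {A B : Finset V} (h : ∀ v, v ∈ A ∨ v ∈ B)
    (hadj : ∀ u v, G.Adj u v → (u ∈ A ∧ v ∈ A) ∨ (u ∈ B ∧ v ∈ B)) : IsSep G A B := by
  refine ⟨by ext v; simpa using h v, fun a ha b hb hab => ?_⟩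
  have := hadj a b hab
  simp only [Finset.mem_sdiff] at ha hb
  grind

theorem IsTangle.mem_of_not_mem_swap {G : SimpleGraph V} {k : ℕ}
    {τ : Set (Finset V × Finset V)} (hτ : IsTangle G k τ) {A B : Finset V} (h : IsSep G A B)
    (hk : (A ∩ B).card < k) (hBA : (B, A) ∉ τ) : (A, B) ∈ τ :=
  (hτ.2.1 A B h hk).2 hBA

theorem IsTangle.univ_empty_not_mem {G : SimpleGraph V} {k : ℕ}
    {τ : Set (Finset V × Finset V)} (hτ : IsTangle G k τ) : (Finset.univ, ∅) ∉ τ := fun h =>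
  hτ.2.2 _ h _ h _ h ⟨by simp, by simp⟩

theorem IsTangle.union_mem {G : SimpleGraph V} {k : ℕ} {τ : Set (Finset V × Finset V)}
    (hτ : IsTangle G k τ) {A B C D : Finset V} (hAB : (A, B) ∈ τ) (hCD : (C, D) ∈ τ)
    (hk : ((A ∪ C) ∩ (B ∩ D)).card < k) : (A ∪ C, B ∩ D) ∈ τ := by
  have h₁ := (hτ.1 _ hAB).1
  have h₂ := (hτ.1 _ hCD).1
  have hcov : CoversG G A C (B ∩ D) := by
    refine ⟨fun v => ?_, fun u v huv => ?_⟩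
    · have := h₁.mem_or_mem v
      have := h₂.mem_or_mem v
      simp only [Finset.mem_inter] at *
      tauto
    · have := h₁.adj_mem huv
      have := h₂.adj_mem huv
      simp only [Finset.mem_inter] at *
      tauto
  refine hτ.mem_of_not_mem_swap (isSep_of_forall_adj (fun v => ?_) fun u v huv => ?_) hk
    fun h => hτ.2.2 _ hAB _ hCD _ h hcov
  · have := hcov.1 v
    simp only [Finset.mem_union] at *
    tauto
  · have := hcov.2 u v huv
    simp only [Finset.mem_union] at *
    tauto

theorem IsTangle.eq_of_subset {G : SimpleGraph V} {k : ℕ} {τ σ : Set (Finset V × Finset V)}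
    (hτ : IsTangle G k τ) (hσ : IsTangle G k σ) (h : τ ⊆ σ) : τ = σ := by
  refine h.antisymm fun ⟨A, B⟩ hp => ?_
  obtain ⟨hs, hk⟩ := hσ.1 _ hp
  exact hτ.mem_of_not_mem_swap hs hk fun hBA => (hσ.2.1 A B hs hk).1 hp (h hBA)

theorem card_compl_inter_self_lt {k : ℕ} (hk : 1 ≤ k) (s : Finset V) : (sᶜ ∩ s).card < k := by
  rw [Finset.inter_comm, Finset.inter_compl, Finset.card_empty]
  exact hk

/-- No edge of `G` leaves `s`. -/
def IsAdjClosed (G : SimpleGraph V) (s : Finset V) : Prop :=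
  ∀ u v, G.Adj u v → (u ∈ s ↔ v ∈ s)

theorem IsAdjClosed.isSep_compl {G : SimpleGraph V} {s : Finset V} (hs : IsAdjClosed G s) :
    IsSep G sᶜ s := by
  refine isSep_of_forall_adj (fun v => ?_) fun u v huv => ?_
  · simp only [Finset.mem_compl]
    tauto
  · have := hs u v huv
    simp only [Finset.mem_compl]
    tauto

theorem IsComponentSet.isAdjClosed {G : SimpleGraph V} {s : Finset V}
    (hs : IsComponentSet G s) : IsAdjClosed G s := by
  obtain ⟨c, hc⟩ := hs
  intro u v huv
  rw [← Finset.mem_coe, ← Finset.mem_coe, hc, SimpleGraph.ConnectedComponent.mem_supp_iff,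
    SimpleGraph.ConnectedComponent.mem_supp_iff,
    SimpleGraph.ConnectedComponent.connectedComponentMk_eq_of_adj huv]

theorem IsComponentSet.eq_of_mem {G : SimpleGraph V} {s t : Finset V}
    (hs : IsComponentSet G s) (ht : IsComponentSet G t) {v : V} (hvs : v ∈ s) (hvt : v ∈ t) :
    s = t := by
  obtain ⟨c, hc⟩ := hs
  obtain ⟨d, hd⟩ := ht
  rw [← Finset.mem_coe, hc, SimpleGraph.ConnectedComponent.mem_supp_iff] at hvs
  rw [← Finset.mem_coe, hd, SimpleGraph.ConnectedComponent.mem_supp_iff] at hvt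
  rw [← Finset.coe_inj, hc, hd, ← hvs, ← hvt]

theorem exists_isComponentSet_mem (G : SimpleGraph V) (v : V) :
    ∃ s, IsComponentSet G s ∧ v ∈ s := by
  classical
  exact ⟨(G.connectedComponentMk v).supp.toFinset, ⟨_, Set.coe_toFinset _⟩, by simp⟩

/-- A tangle points towards some component. -/
theorem IsTangle.exists_isComponentSet {G : SimpleGraph V} {k : ℕ} (hk : 1 ≤ k)
    {τ : Set (Finset V × Finset V)} (hτ : IsTangle G k τ) :
    ∃ s, IsComponentSet G s ∧ (sᶜ, s) ∈ τ := by
  have huniv : IsAdjClosed G Finset.univ ∧ (Finset.univᶜ, Finset.univ) ∈ τ := by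
    have h : IsAdjClosed G Finset.univ := fun u v _ => by simp
    refine ⟨h, hτ.mem_of_not_mem_swap h.isSep_compl (card_compl_inter_self_lt hk _) ?_⟩
    rw [Finset.compl_univ]
    exact hτ.univ_empty_not_mem
  obtain ⟨W, ⟨hW, hWτ⟩, hmin⟩ := Set.Finite.exists_minimal
    (s := {W : Finset V | IsAdjClosed G W ∧ (Wᶜ, W) ∈ τ}) (Set.toFinite _) ⟨_, huniv⟩
  obtain ⟨v, hv⟩ : W.Nonempty := by
    rw [Finset.nonempty_iff_ne_empty]
    rintro rfl
    exact hτ.univ_empty_not_mem (by simpa using hWτ)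
  obtain ⟨s, hs, hvs⟩ := exists_isComponentSet_mem G v
  refine ⟨s, hs, hτ.mem_of_not_mem_swap hs.isAdjClosed.isSep_compl (card_compl_inter_self_lt hk _)
    fun hsτ => ?_⟩
  have hcompl : Wᶜ ∪ s = (W ∩ sᶜ)ᶜ := by rw [Finset.compl_inter, compl_compl]
  have hU := hτ.union_mem hWτ hsτ (hcompl ▸ card_compl_inter_self_lt hk _)
  rw [hcompl] at hU
  have hclosed : IsAdjClosed G (W ∩ sᶜ) := fun u w huw => by
    simp only [Finset.mem_inter, Finset.mem_compl, hW u w huw, hs.isAdjClosed u w huw]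
  have hv' := hmin ⟨hclosed, hU⟩ Finset.inter_subset_left hv
  simp [hvs] at hv'

/-- The image in `V` of a set of vertices of the subgraph on `s`. -/
def liftSet {s : Finset V} (A : Finset {x : V // x ∈ s}) : Finset V :=
  A.map (Function.Embedding.subtype _)

theorem mem_liftSet {s : Finset V} {A : Finset {x : V // x ∈ s}} {v : V} :
    v ∈ liftSet A ↔ ∃ h : v ∈ s, (⟨v, h⟩ : {x : V // x ∈ s}) ∈ A := by
  simp [liftSet]

theorem liftSet_subtype {s : Finset V} (A : Finset V) :
    liftSet (A.subtype (· ∈ s)) = A ∩ s := by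
  ext v
  simp [mem_liftSet, and_comm]

theorem card_liftSet_union_compl_inter {s : Finset V} (A B : Finset {x : V // x ∈ s}) :
    ((liftSet A ∪ sᶜ) ∩ liftSet B).card = (A ∩ B).card := by
  rw [← Finset.card_map (Function.Embedding.subtype _)]
  congr 1
  ext v
  simp only [Finset.mem_inter, Finset.mem_union, Finset.mem_compl, mem_liftSet, Finset.mem_map,
    Function.Embedding.subtype_apply, Subtype.exists, exists_and_right, exists_eq_right]
  grind

theorem IsSep.liftSet_union_compl {G : SimpleGraph V} {s : Finset V} (hs : IsAdjClosed G s)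
    {A B : Finset {x : V // x ∈ s}}
    (h : IsSep (SimpleGraph.comap (Subtype.val : {x : V // x ∈ s} → V) G) A B) :
    IsSep G (liftSet A ∪ sᶜ) (liftSet B) := by
  refine isSep_of_forall_adj (fun v => ?_) fun u v huv => ?_
  · by_cases hv : v ∈ s
    · simpa [mem_liftSet, hv] using h.mem_or_mem ⟨v, hv⟩
    · simp [hv]
  · by_cases hu : u ∈ s
    · have hv := (hs u v huv).1 hu
      simpa [mem_liftSet, hu, hv] using h.adj_mem (u := ⟨u, hu⟩) (v := ⟨v, hv⟩) huv
    · have hv : v ∉ s := fun hv => hu ((hs u v huv).2 hv)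
      simp [hu, hv]

/-- The orientation of the separations of `G[s]` induced by `τ`. -/
def inducedTangle (τ : Set (Finset V × Finset V)) (s : Finset V) :
    Set (Finset {x : V // x ∈ s} × Finset {x : V // x ∈ s}) :=
  {p | (liftSet p.1 ∪ sᶜ, liftSet p.2) ∈ τ}

theorem CoversG.liftSet_union_compl {G : SimpleGraph V} {s : Finset V} (hs : IsAdjClosed G s)
    {A B C : Finset {x : V // x ∈ s}}
    (h : CoversG (SimpleGraph.comap (Subtype.val : {x : V // x ∈ s} → V) G) A B C) :
    CoversG G (liftSet A ∪ sᶜ) (liftSet B ∪ sᶜ) (liftSet C ∪ sᶜ) := by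
  refine ⟨fun v => ?_, fun u v huv => ?_⟩
  · by_cases hv : v ∈ s
    · simpa [mem_liftSet, hv] using h.1 ⟨v, hv⟩
    · simp [hv]
  · by_cases hu : u ∈ s
    · have hv := (hs u v huv).1 hu
      simpa [mem_liftSet, hu, hv] using h.2 ⟨u, hu⟩ ⟨v, hv⟩ huv
    · have hv : v ∉ s := fun hv => hu ((hs u v huv).2 hv)
      simp [hu, hv]

theorem IsTangle.isTangle_inducedTangle {G : SimpleGraph V} {k : ℕ} {τ : Set (Finset V × Finset V)}
    (hτ : IsTangle G k τ) {s : Finset V} (hs : IsAdjClosed G s) (hsτ : (sᶜ, s) ∈ τ) :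
    IsTangle (SimpleGraph.comap (Subtype.val : {x : V // x ∈ s} → V) G) k
      (inducedTangle τ s) := by
  refine ⟨fun ⟨A, B⟩ hp => ?_, fun A B hAB hk => ⟨fun hp hq => ?_, fun hq => ?_⟩,
    fun p₁ h₁ p₂ h₂ p₃ h₃ hcov => hτ.2.2 _ h₁ _ h₂ _ h₃ (hcov.liftSet_union_compl hs)⟩
  · obtain ⟨h, hcard⟩ := hτ.1 _ hp
    refine ⟨isSep_of_forall_adj (fun v => ?_) fun u v huv => ?_, ?_⟩
    · simpa [mem_liftSet, v.2] using h.mem_or_mem v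
    · simpa [mem_liftSet, u.2, v.2] using h.adj_mem (u := u) (v := v) huv
    · rwa [card_liftSet_union_compl_inter] at hcard
  · refine hτ.2.2 _ hp _ hq _ hq (CoversG.liftSet_union_compl hs ⟨fun v => ?_, fun u v huv => ?_⟩)
    · have := hAB.mem_or_mem v
      tauto
    · have := hAB.adj_mem huv
      tauto
  · by_contra hp
    have hBA := hτ.mem_of_not_mem_swap (hAB.liftSet_union_compl hs).symm
      (by rwa [Finset.inter_comm, card_liftSet_union_compl_inter]) hp
    have hAB' := hτ.mem_of_not_mem_swap (hAB.symm.liftSet_union_compl hs).symm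
      (by rwa [Finset.inter_comm, card_liftSet_union_compl_inter, Finset.inter_comm]) hq
    refine hτ.2.2 _ hBA _ hAB' _ hsτ ⟨fun v => ?_, fun u v huv => ?_⟩
    · have := (hAB.liftSet_union_compl hs).mem_or_mem v
      simp only [Finset.mem_union] at *
      tauto
    · have := (hAB.liftSet_union_compl hs).adj_mem huv
      have := hs u v huv
      by_cases hu : u ∈ s
      · simp_all [mem_liftSet]
        tauto
      · simp_all [mem_liftSet]

theorem IsTangle.extendsToComponent {G : SimpleGraph V} {k : ℕ} {τ : Set (Finset V × Finset V)}
    (hτ : IsTangle G k τ) {s : Finset V} (hsτ : (sᶜ, s) ∈ τ) :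
    ExtendsToComponent τ s (inducedTangle τ s) := by
  rintro ⟨A, B⟩ hp
  have hU := hτ.union_mem hp hsτ ((Finset.card_le_card fun v hv => by
    simp only [Finset.mem_inter, Finset.mem_union, Finset.mem_compl] at *
    tauto).trans_lt (hτ.1 _ hp).2)
  have h : A ∪ sᶜ = A ∩ s ∪ sᶜ := by
    ext v
    simp only [Finset.mem_inter, Finset.mem_union, Finset.mem_compl]
    tauto
  simpa only [inducedTangle, Set.mem_ofPred_eq, liftSet_subtype, ← h] using hU

/-- A tangle of `G` points towards each component to which it extends. -/
theorem ExtendsToComponent.compl_mem {G : SimpleGraph V} {k : ℕ} (hk : 1 ≤ k)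
    {τ : Set (Finset V × Finset V)} (hτ : IsTangle G k τ) {s : Finset V}
    (hs : IsAdjClosed G s) {H : SimpleGraph {x : V // x ∈ s}}
    {σ : Set (Finset {x : V // x ∈ s} × Finset {x : V // x ∈ s})} (hσ : IsTangle H k σ)
    (h : ExtendsToComponent τ s σ) : (sᶜ, s) ∈ τ := by
  refine hτ.mem_of_not_mem_swap hs.isSep_compl (card_compl_inter_self_lt hk _) fun hsτ =>
    hσ.univ_empty_not_mem ?_
  have h₁ : s.subtype (· ∈ s) = Finset.univ := by ext; simp
  have h₂ : sᶜ.subtype (· ∈ s) = ∅ := by ext; simp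
  simpa only [h₁, h₂] using h _ hsτ

/-- For every `k`-tangle `τ` in `G` there is a unique component `G'` of `G` such that `τ`
extends to a `k`-tangle in `G'`, and moreover `τ'` is the unique such `k`-tangle in `G'`. -/
theorem stmt7 (k : ℕ) (hk : 1 ≤ k) (G : SimpleGraph V)
    (τ : Set (Finset V × Finset V)) (hτ : IsTangle G k τ) :
    ∃ s : Finset V, IsComponentSet G s ∧
      (∃! τ' : Set (Finset {x : V // x ∈ s} × Finset {x : V // x ∈ s}),
        IsTangle (SimpleGraph.comap (Subtype.val : {x : V // x ∈ s} → V) G) k τ' ∧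
          ExtendsToComponent τ s τ') ∧
      ∀ s' : Finset V, IsComponentSet G s' →
        (∃ τ' : Set (Finset {x : V // x ∈ s'} × Finset {x : V // x ∈ s'}),
          IsTangle (SimpleGraph.comap (Subtype.val : {x : V // x ∈ s'} → V) G) k τ' ∧
            ExtendsToComponent τ s' τ') → s' = s := by
  obtain ⟨s, hs, hsτ⟩ := hτ.exists_isComponentSet hk
  refine ⟨s, hs, ⟨inducedTangle τ s, ⟨hτ.isTangle_inducedTangle hs.isAdjClosed hsτ,
    hτ.extendsToComponent hsτ⟩, fun σ ⟨hσ, hext⟩ => ?_⟩, fun t ht ⟨σ, hσ, hext⟩ => ?_⟩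
  · refine ((hτ.isTangle_inducedTangle hs.isAdjClosed hsτ).eq_of_subset hσ fun ⟨A, B⟩ hp => ?_).symm
    have h₁ : (liftSet A ∪ sᶜ).subtype (· ∈ s) = A := by
      ext v
      simp [mem_liftSet]
    have h₂ : (liftSet B).subtype (· ∈ s) = B := by
      ext v
      simp [mem_liftSet]
    simpa only [h₁, h₂] using hext _ hp
  · by_contra hne
    have htτ := hext.compl_mem hk hτ ht.isAdjClosed hσ
    have hdisj : ∀ v, v ∈ t → v ∉ s := fun v hvt hvs => hne (ht.eq_of_mem hs hvt hvs)
    refine hτ.2.2 _ hsτ _ htτ _ htτ ⟨fun v => ?_, fun u v huv => ?_⟩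
    · have := hdisj v
      simp only [Finset.mem_compl]
      tauto
    · have := hdisj u
      have := hdisj v
      have := ht.isAdjClosed u v huv
      simp only [Finset.mem_compl]
      tauto
end

section
/- Let k ≥ 3 be an integer, let τ be a k-tangle in a graph G, let e be an edge of G, and let {A,B} be a separation of G − e such that e has one endvertex in A \ B and the other in B \ A. Write A ∪ e for A together with the endvertex of e in B \ A, and B ∪ e for B together with the endvertex of e in A \ B. If |A ∩ B| < k − 1, then (A ∪ e, B) ∈ τ if and only if (A, B ∪ e) ∈ τ. -/
open Finset

variable {V : Type} [Fintype V] [DecidableEq V]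

/-- A `k`-tangle orients `{S, V}` towards `V` whenever `|S| < k`, because `V` cannot be the
small side of one of its elements. -/
theorem IsTangle.mk_univ_mem {G : SimpleGraph V} {k : ℕ} {τ : Set (Finset V × Finset V)}
    (hτ : IsTangle G k τ) {S : Finset V} (hS : S.card < k) : (S, Finset.univ) ∈ τ := by
  refine (hτ.2.1 S Finset.univ ⟨by simp, by simp⟩ (by simpa using hS)).2 fun h => ?_
  exact hτ.2.2 _ h _ h _ h ⟨by simp, by simp⟩

/-- An edge of `G` other than `xy` lies on one of the sides of a separation of `G - xy`. -/
theorem IsSep.edge_mem_side {G : SimpleGraph V} {x y : V} {A B : Finset V}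
    (hsep : IsSep (G.deleteEdges {s(x, y)}) A B) {u v : V} (huv : G.Adj u v) :
    (u ∈ A ∧ v ∈ A) ∨ (u ∈ B ∧ v ∈ B) ∨ (u = x ∧ v = y) ∨ (u = y ∧ v = x) := by
  have hcov : ∀ w, w ∈ A ∨ w ∈ B := fun w => by
    rw [← Finset.mem_union, hsep.1]; exact Finset.mem_univ w
  have key : ∀ a b, G.Adj a b → a ∈ A → a ∉ B → b ∈ B → b ∉ A →
      (a = x ∧ b = y) ∨ (a = y ∧ b = x) := fun a b hab ha ha' hb hb' => by
    by_contra hne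
    refine hsep.2 a (Finset.mem_sdiff.2 ⟨ha, ha'⟩) b (Finset.mem_sdiff.2 ⟨hb, hb'⟩) ?_
    simpa [SimpleGraph.deleteEdges_adj, hab] using hne
  have h₁ := key u v huv
  have h₂ := key v u huv.symm
  rcases hcov u with hu | hu <;> rcases hcov v with hv | hv <;> tauto

/-- Let `k ≥ 3`, let `τ` be a `k`-tangle in `G`, let `e = xy` be an edge of `G`, and let
`{A, B}` be a separation of `G - e` with `x ∈ A \ B` and `y ∈ B \ A`.  If `|A ∩ B| < k - 1`,
then `(A ∪ e, B) ∈ τ` iff `(A, B ∪ e) ∈ τ` (where `A ∪ e = A ∪ {y}` and `B ∪ e = B ∪ {x}`). -/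
theorem stmt11 (k : ℕ) (hk : 3 ≤ k) (G : SimpleGraph V)
    (τ : Set (Finset V × Finset V)) (hτ : IsTangle G k τ)
    (x y : V) (hxy : G.Adj x y) (A B : Finset V)
    (hsep : IsSep (G.deleteEdges {s(x, y)}) A B)
    (hx : x ∈ A \ B) (hy : y ∈ B \ A)
    (horder : (A ∩ B).card < k - 1) :
    (insert y A, B) ∈ τ ↔ (A, insert x B) ∈ τ := by
  have hcov : ∀ w, w ∈ A ∨ w ∈ B := fun w => by
    rw [← Finset.mem_union, hsep.1]; exact Finset.mem_univ w
  rw [Finset.mem_sdiff] at hx hy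
  have hsepA : IsSep G (insert y A) B := by
    refine ⟨by ext w; have := hcov w; simp; tauto, fun a ha b hb hab => ?_⟩
    simp only [Finset.mem_sdiff, Finset.mem_insert] at ha hb
    have := hsep.edge_mem_side hab
    grind
  have hsepB : IsSep G A (insert x B) := by
    refine ⟨by ext w; have := hcov w; simp; tauto, fun a ha b hb hab => ?_⟩
    simp only [Finset.mem_sdiff, Finset.mem_insert] at ha hb
    have := hsep.edge_mem_side hab
    grind
  have hcardA : (insert y A ∩ B).card < k := by
    rw [Finset.insert_inter_of_mem hy.1]
    have := Finset.card_insert_le y (A ∩ B)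
    omega
  have hcardB : (A ∩ insert x B).card < k := by
    rw [Finset.inter_insert_of_mem hx.1]
    have := Finset.card_insert_le x (A ∩ B)
    omega
  constructor
  · intro h
    refine (hτ.2.1 _ _ hsepB hcardB).2 fun h' => ?_
    refine hτ.2.2 _ h _ h' _ h' ⟨fun w => ?_, fun u v huv => ?_⟩
    · have := hcov w
      simp only [Finset.mem_insert]
      tauto
    · have := hsep.edge_mem_side huv
      simp only [Finset.mem_insert]
      grind
  · intro h
    refine (hτ.2.1 _ _ hsepA hcardA).2 fun h' => ?_
    have hpair : ({x, y} : Finset V).card < k := Finset.card_le_two.trans_lt hk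
    refine hτ.2.2 _ h _ h' _ (hτ.mk_univ_mem hpair) ⟨fun w => ?_, fun u v huv => ?_⟩
    · have := hcov w
      tauto
    · have := hsep.edge_mem_side huv
      simp only [Finset.mem_insert, Finset.mem_singleton]
      tauto
end

section
/- Let k ≥ 2 be an integer and let τ be a k-tangle in a graph G. If there exists a (k+1)-tangle τ̃ in G with τ ⊄ τ̃, then there exists an edge e of G such that τ extends to a k-tangle τ' in G − e. -/
open Finset

variable {V : Type} [Fintype V] [DecidableEq V]

theorem isSep_iff {G : SimpleGraph V} {A B : Finset V} :
    IsSep G A B ↔ (∀ x, x ∈ A ∨ x ∈ B) ∧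
      ∀ a b, G.Adj a b → (a ∈ A ∧ b ∈ A) ∨ (a ∈ B ∧ b ∈ B) := by
  constructor
  · rintro ⟨hcov, hadj⟩
    have hcov' : ∀ x, x ∈ A ∨ x ∈ B := fun x => by
      rw [← mem_union, hcov]; exact mem_univ x
    refine ⟨hcov', fun a b hab => ?_⟩
    simp only [mem_sdiff] at hadj
    grind [SimpleGraph.Adj.symm]
  · rintro ⟨hcov, hadj⟩
    refine ⟨by ext x; simpa using hcov x, fun a ha b hb hab => ?_⟩
    simp only [mem_sdiff] at ha hb
    have := hadj a b hab
    tauto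

theorem isSep_deleteEdge_iff {G : SimpleGraph V} {u v : V} {C D : Finset V} :
    IsSep (G.deleteEdges {s(u, v)}) C D ↔ (∀ x, x ∈ C ∨ x ∈ D) ∧
      ∀ a b, G.Adj a b → (a = u ∧ b = v) ∨ (a = v ∧ b = u) ∨
        (a ∈ C ∧ b ∈ C) ∨ (a ∈ D ∧ b ∈ D) := by
  simp only [isSep_iff, SimpleGraph.deleteEdges_adj, Set.mem_singleton_iff, Sym2.eq_iff]
  refine and_congr_right fun _ => forall₂_congr fun a b => ?_
  tauto

theorem coversG_deleteEdge_iff {W : Type} {G : SimpleGraph W} {u v : W} {C₁ C₂ C₃ : Finset W} :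
    CoversG (G.deleteEdges {s(u, v)}) C₁ C₂ C₃ ↔ (∀ x, x ∈ C₁ ∨ x ∈ C₂ ∨ x ∈ C₃) ∧
      ∀ a b, G.Adj a b → (a = u ∧ b = v) ∨ (a = v ∧ b = u) ∨
        (a ∈ C₁ ∧ b ∈ C₁) ∨ (a ∈ C₂ ∧ b ∈ C₂) ∨ (a ∈ C₃ ∧ b ∈ C₃) := by
  simp only [CoversG, SimpleGraph.deleteEdges_adj, Set.mem_singleton_iff, Sym2.eq_iff]
  refine and_congr_right fun _ => forall₂_congr fun a b => ?_
  tauto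

theorem card_corners_le {α : Type*} [DecidableEq α] (A B C D : Finset α) :
    ((A ∪ C) ∩ (B ∩ D)).card + ((A ∩ C) ∩ (B ∪ D)).card ≤ (A ∩ B).card + (C ∩ D).card := by
  rw [← card_union_add_card_inter, ← card_union_add_card_inter (A ∩ B)]
  apply Nat.add_le_add <;> apply card_le_card <;> intro x <;>
    simp only [mem_union, mem_inter] <;> tauto

namespace IsTangle

variable {G : SimpleGraph V} {k : ℕ} {τ : Set (Finset V × Finset V)}

theorem isSep (h : IsTangle G k τ) {A B : Finset V} (hAB : (A, B) ∈ τ) : IsSep G A B :=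
  (h.1 _ hAB).1

theorem card_lt (h : IsTangle G k τ) {A B : Finset V} (hAB : (A, B) ∈ τ) : (A ∩ B).card < k :=
  (h.1 _ hAB).2

theorem not_covers (h : IsTangle G k τ) {A₁ B₁ A₂ B₂ A₃ B₃ : Finset V} (h₁ : (A₁, B₁) ∈ τ)
    (h₂ : (A₂, B₂) ∈ τ) (h₃ : (A₃, B₃) ∈ τ) : ¬ CoversG G A₁ A₂ A₃ :=
  h.2.2 _ h₁ _ h₂ _ h₃

theorem mem_or_mem (h : IsTangle G k τ) {A B : Finset V} (hs : IsSep G A B)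
    (hc : (A ∩ B).card < k) : (A, B) ∈ τ ∨ (B, A) ∈ τ := by
  have := h.2.1 A B hs hc
  tauto

theorem not_mem_swap (h : IsTangle G k τ) {A B : Finset V} (hAB : (A, B) ∈ τ) : (B, A) ∉ τ :=
  (h.2.1 A B (h.isSep hAB) (h.card_lt hAB)).1 hAB

theorem mem_of_covers (h : IsTangle G k τ) {X Y A₁ B₁ A₂ B₂ : Finset V} (hs : IsSep G X Y)
    (hc : (X ∩ Y).card < k) (h₁ : (A₁, B₁) ∈ τ) (h₂ : (A₂, B₂) ∈ τ)
    (hcov : CoversG G Y A₁ A₂) : (X, Y) ∈ τ :=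
  (h.mem_or_mem hs hc).resolve_right fun hYX => h.not_covers hYX h₁ h₂ hcov

theorem pair_mem (h : IsTangle G k τ) (hk : 2 < k) (u v : V) : ({u, v}, univ) ∈ τ := by
  have hs : IsSep G {u, v} univ := isSep_iff.2 ⟨by simp, by simp⟩
  refine (h.mem_or_mem hs ?_).resolve_right fun h' => h.not_covers h' h' h' ⟨by simp, by simp⟩
  rw [inter_univ]
  exact card_le_two.trans_lt hk

end IsTangle

/-- `(A, B)` distinguishes `τ` from `σ`, and among all such separations it has least order and,
subject to that, a smallest side `A`. -/
structure IsExtremal (τ σ : Set (Finset V × Finset V)) (A B : Finset V) : Prop where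
  mem : (A, B) ∈ τ
  swap_mem : (B, A) ∈ σ
  card_le : ∀ X Y, (X, Y) ∈ τ → (Y, X) ∈ σ → (A ∩ B).card ≤ (X ∩ Y).card
  card_left_le : ∀ X Y, (X, Y) ∈ τ → (Y, X) ∈ σ → (X ∩ Y).card ≤ (A ∩ B).card →
    A.card ≤ X.card

theorem exists_isExtremal {G : SimpleGraph V} {k : ℕ} {τ σ : Set (Finset V × Finset V)}
    (hτ : IsTangle G k τ) (hσ : IsTangle G (k + 1) σ) (hnsub : ¬ τ ⊆ σ) :
    ∃ A B, IsExtremal τ σ A B := by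
  obtain ⟨⟨A₀, B₀⟩, h₀, h₀'⟩ := Set.not_subset.1 hnsub
  have h₁ : (B₀, A₀) ∈ σ :=
    (hσ.mem_or_mem (hτ.isSep h₀) ((hτ.card_lt h₀).trans (Nat.lt_succ_self k))).resolve_left h₀'
  obtain ⟨⟨A, B⟩, ⟨hA, hB⟩, hmin⟩ := Set.exists_min_image
    {p : Finset V × Finset V | p ∈ τ ∧ p.swap ∈ σ}
    (fun p => toLex ((p.1 ∩ p.2).card, p.1.card)) (Set.toFinite _) ⟨(A₀, B₀), h₀, h₁⟩
  have hle : ∀ X Y, (X, Y) ∈ τ → (Y, X) ∈ σ → (A ∩ B).card < (X ∩ Y).card ∨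
      (A ∩ B).card = (X ∩ Y).card ∧ A.card ≤ X.card := fun X Y hX hY => by
    simpa [Prod.Lex.le_iff] using hmin (X, Y) ⟨hX, hY⟩
  refine ⟨A, B, hA, hB, fun X Y hX hY => ?_, fun X Y hX hY h => ?_⟩ <;>
    have := hle X Y hX hY <;> omega

section Extremal

variable {G : SimpleGraph V} {k : ℕ} {τ σ : Set (Finset V × Finset V)} {A B : Finset V}

theorem IsExtremal.exists_adj (hAB : IsExtremal τ σ A B) (hk : 2 ≤ k) (hτ : IsTangle G k τ)
    (hσ : IsTangle G (k + 1) σ) : ∃ u ∈ A, ∃ v ∈ A, G.Adj u v := by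
  by_contra! hno
  have hsep := isSep_iff.1 (hτ.isSep hAB.mem)
  have hw : ∃ w ∈ A, w ∉ B := by
    by_contra! hsub
    have hB : ∀ x, x ∈ B := fun x => (hsep.1 x).elim (hsub x) id
    exact hσ.not_covers hAB.swap_mem hAB.swap_mem hAB.swap_mem ⟨by simp [hB], by simp [hB]⟩
  obtain ⟨w, hwA, hwB⟩ := hw
  have hs : IsSep G (A.erase w) (insert w B) := by
    rw [isSep_iff]
    grind
  have hc : (A.erase w ∩ insert w B) = A ∩ B := by grind
  have hck := hτ.card_lt hAB.mem
  have h₁ : (A.erase w, insert w B) ∈ τ := by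
    refine hτ.mem_of_covers hs (hc ▸ hck) hAB.mem hAB.mem ?_
    unfold CoversG; grind
  have h₂ : (insert w B, A.erase w) ∈ σ := by
    refine hσ.mem_of_covers hs.symm (by rw [inter_comm, hc]; omega) hAB.swap_mem
      (hσ.pair_mem (by omega) w w) ?_
    unfold CoversG; grind
  have h₃ := hAB.card_left_le _ _ h₁ h₂ (by rw [hc])
  exact absurd h₃ (not_le.2 (card_erase_lt_of_mem hwA))

theorem IsExtremal.mem_of_le_card_corner (hAB : IsExtremal τ σ A B) (hτ : IsTangle G k τ)
    (hσ : IsTangle G (k + 1) σ) {C D : Finset V} (hs : IsSep G C D) (hc : (C ∩ D).card < k)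
    (hcorner : k ≤ ((A ∪ C) ∩ (B ∩ D)).card) : (C, D) ∈ σ := by
  refine (hσ.mem_or_mem hs (by omega)).resolve_right fun hDC => ?_
  have hsub := card_corners_le A B C D
  have hck := hτ.card_lt hAB.mem
  have hAB' := isSep_iff.1 (hτ.isSep hAB.mem)
  have hs' := isSep_iff.1 hs
  have hX : IsSep G (A ∩ C) (B ∪ D) := by
    rw [isSep_iff]
    grind
  have h₁ : (A ∩ C, B ∪ D) ∈ τ := by
    refine hτ.mem_of_covers hX (by omega) hAB.mem hAB.mem ?_
    unfold CoversG; grind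
  have h₂ : (B ∪ D, A ∩ C) ∈ σ := by
    refine hσ.mem_of_covers hX.symm (by rw [inter_comm]; omega) hAB.swap_mem hDC ?_
    unfold CoversG; grind
  have := hAB.card_le _ _ h₁ h₂
  omega

theorem IsExtremal.insert_mem_of_crosses (hAB : IsExtremal τ σ A B) (hk : 2 ≤ k)
    (hτ : IsTangle G k τ) (hσ : IsTangle G (k + 1) σ) {u v : V} (hvA : v ∈ A) {C D : Finset V}
    (hs : IsSep (G.deleteEdges {s(u, v)}) C D) (hc : (C ∩ D).card < k)
    (hcorner : k ≤ ((A ∪ C) ∩ (B ∩ D)).card) (huC : u ∈ C) (hvC : v ∉ C) :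
    (insert v C, D) ∈ σ := by
  have hs' := isSep_deleteEdge_iff.1 hs
  have hsC : IsSep G (insert v C) D := by
    rw [isSep_iff]
    grind
  have hsD : IsSep G (insert u D) C := by
    rw [isSep_iff]
    grind
  have hcC : (insert v C ∩ D).card ≤ (C ∩ D).card + 1 :=
    (card_le_card (t := insert v (C ∩ D)) (by grind)).trans (card_insert_le _ _)
  have hcD : (insert u D ∩ C).card ≤ (C ∩ D).card + 1 :=
    (card_le_card (t := insert u (C ∩ D)) (by grind)).trans (card_insert_le _ _)
  have huv := hσ.pair_mem (by omega) u v
  refine (hσ.mem_or_mem hsC (by omega)).resolve_right fun hDC => ?_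
  have hDC' : (insert u D, C) ∈ σ := by
    refine hσ.mem_of_covers hsD (by omega) hDC huv ?_
    unfold CoversG; grind
  have hsub := card_corners_le A B C D
  have hck := hτ.card_lt hAB.mem
  have hAB' := isSep_iff.1 (hτ.isSep hAB.mem)
  have hX : IsSep G (A ∩ C) (insert u (B ∪ D)) := by
    rw [isSep_iff]
    grind
  have hcX : ((A ∩ C) ∩ insert u (B ∪ D)).card ≤ ((A ∩ C) ∩ (B ∪ D)).card + 1 :=
    (card_le_card (t := insert u ((A ∩ C) ∩ (B ∪ D))) (by grind)).trans (card_insert_le _ _)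
  have h₁ : (A ∩ C, insert u (B ∪ D)) ∈ τ := by
    refine hτ.mem_of_covers hX (by omega) hAB.mem hAB.mem ?_
    unfold CoversG; grind
  have h₂ : (insert u (B ∪ D), A ∩ C) ∈ σ := by
    refine hσ.mem_of_covers hX.symm (by rw [inter_comm]; omega) hAB.swap_mem hDC' ?_
    unfold CoversG; grind
  have h₃ := hAB.card_left_le _ _ h₁ h₂ (by omega)
  have h₄ : (A ∩ C).card < A.card := card_lt_card (by grind)
  omega

theorem IsExtremal.exists_mem_of_le_card_corner (hAB : IsExtremal τ σ A B) (hk : 2 ≤ k)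
    (hτ : IsTangle G k τ) (hσ : IsTangle G (k + 1) σ) {u v : V} (huA : u ∈ A) (hvA : v ∈ A)
    {C D : Finset V} (hs : IsSep (G.deleteEdges {s(u, v)}) C D) (hc : (C ∩ D).card < k)
    (hcorner : k ≤ ((A ∪ C) ∩ (B ∩ D)).card) :
    ∃ C', (C', D) ∈ σ ∧ C ⊆ C' ∧ (u ∈ C ∨ v ∈ C → u ∈ C' ∧ v ∈ C') := by
  by_cases huv : u ∈ C ∧ v ∉ C ∧ v ∈ D ∧ u ∉ D
  · exact ⟨_, hAB.insert_mem_of_crosses hk hτ hσ hvA hs hc hcorner huv.1 huv.2.1,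
      subset_insert _ _, by grind⟩
  by_cases hvu : v ∈ C ∧ u ∉ C ∧ u ∈ D ∧ v ∉ D
  · rw [Sym2.eq_swap] at hs
    exact ⟨_, hAB.insert_mem_of_crosses hk hτ hσ huA hs hc hcorner hvu.1 hvu.2.1,
      subset_insert _ _, by grind⟩
  have hs' := isSep_deleteEdge_iff.1 hs
  have hsG : IsSep G C D := by
    rw [isSep_iff]
    grind
  have hCD := hAB.mem_of_le_card_corner hτ hσ hsG hc hcorner
  by_cases hmeet : u ∈ C ∨ v ∈ C
  swap
  · exact ⟨C, hCD, subset_rfl, fun h => absurd h hmeet⟩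
  refine ⟨C ∪ {u, v}, ?_, subset_union_left, by simp⟩
  have hcC : ((C ∪ {u, v}) ∩ D).card ≤ (C ∩ D).card + 1 := by
    rcases hmeet with h | h
    · exact (card_le_card (t := insert v (C ∩ D)) (by grind)).trans (card_insert_le _ _)
    · exact (card_le_card (t := insert u (C ∩ D)) (by grind)).trans (card_insert_le _ _)
  have hsG' := isSep_iff.1 hsG
  refine hσ.mem_of_covers ?_ (by omega) hCD (hσ.pair_mem (by omega) u v) ?_
  · rw [isSep_iff]
    grind
  · unfold CoversG; grind

/-- The orientations of the separations of order `< k` of `H` that are induced by `τ` through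
their corners with `B`. -/
def cornerOrientation (H : SimpleGraph V) (k : ℕ) (τ : Set (Finset V × Finset V))
    (A B : Finset V) : Set (Finset V × Finset V) :=
  {p | IsSep H p.1 p.2 ∧ (p.1 ∩ p.2).card < k ∧ ((A ∪ p.1, B ∩ p.2) ∈ τ ∨
    (B ∩ p.1, A ∪ p.2) ∈ τ ∧ k ≤ ((A ∪ p.1) ∩ (B ∩ p.2)).card)}

theorem isSep_corner {u v : V} (huA : u ∈ A) (hvA : v ∈ A) (hAB : IsSep G A B)
    {C D : Finset V} (hs : IsSep (G.deleteEdges {s(u, v)}) C D) :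
    IsSep G (A ∪ C) (B ∩ D) := by
  rw [isSep_deleteEdge_iff] at hs
  rw [isSep_iff] at hAB ⊢
  grind

theorem IsExtremal.card_corner_lt_or (hAB : IsExtremal τ σ A B) (hk : 2 ≤ k)
    (hτ : IsTangle G k τ) (hσ : IsTangle G (k + 1) σ) {u v : V} (huA : u ∈ A) (hvA : v ∈ A)
    {C D : Finset V} (hs : IsSep (G.deleteEdges {s(u, v)}) C D) (hc : (C ∩ D).card < k) :
    ((A ∪ C) ∩ (B ∩ D)).card < k ∨ ((A ∪ D) ∩ (B ∩ C)).card < k := by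
  by_contra! h
  obtain ⟨C', hC', hsubC, hC'e⟩ :=
    hAB.exists_mem_of_le_card_corner hk hτ hσ huA hvA hs hc h.1
  obtain ⟨D', hD', hsubD, hD'e⟩ :=
    hAB.exists_mem_of_le_card_corner hk hτ hσ huA hvA hs.symm (inter_comm C D ▸ hc) h.2
  have hs' := isSep_deleteEdge_iff.1 hs
  refine hσ.not_covers hC' hD' hD' ?_
  unfold CoversG; grind

theorem IsExtremal.isTangle_cornerOrientation (hAB : IsExtremal τ σ A B) (hk : 2 ≤ k)
    (hτ : IsTangle G k τ) (hσ : IsTangle G (k + 1) σ) {u v : V} (huA : u ∈ A) (hvA : v ∈ A) :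
    IsTangle (G.deleteEdges {s(u, v)}) k
      (cornerOrientation (G.deleteEdges {s(u, v)}) k τ A B) := by
  have hsAB := hτ.isSep hAB.mem
  have hAB' := isSep_iff.1 hsAB
  refine ⟨fun p hp => ⟨hp.1, hp.2.1⟩, fun C D hs hc => ?_, ?_⟩
  · have hs' := isSep_deleteEdge_iff.1 hs
    have hc' : (D ∩ C).card < k := inter_comm C D ▸ hc
    have hP : (A ∪ C, B ∩ D) ∈ τ → (A ∪ D, B ∩ C) ∉ τ := fun h₁ h₂ => by
      refine hτ.not_covers h₁ h₂ h₂ ?_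
      unfold CoversG; grind
    have hQ : (B ∩ C, A ∪ D) ∈ τ → (B ∩ D, A ∪ C) ∉ τ := fun h₁ h₂ => by
      refine hτ.not_covers h₁ h₂ hAB.mem ?_
      unfold CoversG; grind
    constructor
    · rintro ⟨-, -, h | ⟨h, -⟩⟩ ⟨-, -, h' | ⟨h', -⟩⟩
      · exact hP h h'
      · exact hτ.not_mem_swap h h'
      · exact hτ.not_mem_swap h h'
      · exact hQ h h'
    · intro hDC
      have hD₁ : (A ∪ D, B ∩ C) ∉ τ := fun h => hDC ⟨hs.symm, hc', Or.inl h⟩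
      have hD₂ : (B ∩ D, A ∪ C) ∈ τ → ((A ∪ D) ∩ (B ∩ C)).card < k := fun h =>
        not_le.1 fun h' => hDC ⟨hs.symm, hc', Or.inr ⟨h, h'⟩⟩
      have hD : ((A ∪ D) ∩ (B ∩ C)).card < k → (B ∩ C, A ∪ D) ∈ τ := fun h =>
        (hτ.mem_or_mem (isSep_corner huA hvA hsAB hs.symm) h).resolve_left hD₁
      refine ⟨hs, hc, ?_⟩
      rcases lt_or_ge ((A ∪ C) ∩ (B ∩ D)).card k with h | h
      · refine Or.inl ((hτ.mem_or_mem (isSep_corner huA hvA hsAB hs) h).resolve_right fun h' => ?_)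
        exact hQ (hD (hD₂ h')) h'
      · exact Or.inr ⟨hD ((hAB.card_corner_lt_or hk hτ hσ huA hvA hs hc).resolve_left
          (not_lt.2 h)), h⟩
  · rintro ⟨C₁, D₁⟩ ⟨hs₁, hc₁, h₁⟩ ⟨C₂, D₂⟩ ⟨hs₂, hc₂, h₂⟩ ⟨C₃, D₃⟩ ⟨hs₃, hc₃, h₃⟩ hcov
    have hcov' := coversG_deleteEdge_iff.1 hcov
    by_cases hP : (A ∪ C₁, B ∩ D₁) ∈ τ ∨ (A ∪ C₂, B ∩ D₂) ∈ τ ∨ (A ∪ C₃, B ∩ D₃) ∈ τ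
    · have hmem : ∀ {C D : Finset V}, (A ∪ C, B ∩ D) ∈ τ ∨ (B ∩ C, A ∪ D) ∈ τ ∧
          k ≤ ((A ∪ C) ∩ (B ∩ D)).card → ∃ X Y, (X, Y) ∈ τ ∧ B ∩ C ⊆ X ∧
          ((A ∪ C, B ∩ D) ∈ τ → A ⊆ X) := by
        intro C D h
        by_cases h' : (A ∪ C, B ∩ D) ∈ τ
        · exact ⟨_, _, h', by grind, by grind⟩
        · exact ⟨_, _, (h.resolve_left h').1, subset_rfl, fun h => absurd h h'⟩
      obtain ⟨X₁, Y₁, hX₁, hB₁, hA₁⟩ := hmem h₁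
      obtain ⟨X₂, Y₂, hX₂, hB₂, hA₂⟩ := hmem h₂
      obtain ⟨X₃, Y₃, hX₃, hB₃, hA₃⟩ := hmem h₃
      have hA : A ⊆ X₁ ∨ A ⊆ X₂ ∨ A ⊆ X₃ := hP.imp hA₁ (Or.imp hA₂ hA₃)
      clear hmem hA₁ hA₂ hA₃ hP h₁ h₂ h₃
      refine hτ.not_covers hX₁ hX₂ hX₃ ⟨fun x => ?_, fun a b hab => ?_⟩
      · have := hAB'.1 x
        have := hcov'.1 x
        grind
      · have := hAB'.2 a b hab
        have := hcov'.2 a b hab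
        grind
    · simp only [not_or] at hP
      obtain ⟨X₁, hX₁, hC₁, he₁⟩ := hAB.exists_mem_of_le_card_corner hk hτ hσ huA hvA hs₁ hc₁
        (h₁.resolve_left hP.1).2
      obtain ⟨X₂, hX₂, hC₂, he₂⟩ := hAB.exists_mem_of_le_card_corner hk hτ hσ huA hvA hs₂ hc₂
        (h₂.resolve_left hP.2.1).2
      obtain ⟨X₃, hX₃, hC₃, he₃⟩ := hAB.exists_mem_of_le_card_corner hk hτ hσ huA hvA hs₃ hc₃
        (h₃.resolve_left hP.2.2).2
      refine hσ.not_covers hX₁ hX₂ hX₃ ⟨fun x => ?_, fun a b hab => ?_⟩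
      · have := hcov'.1 x
        grind
      · have := hcov'.1 u
        have := hcov'.2 a b hab
        grind

theorem IsExtremal.subset_cornerOrientation (hAB : IsExtremal τ σ A B) (hk : 2 ≤ k)
    (hτ : IsTangle G k τ) (hσ : IsTangle G (k + 1) σ) {u v : V} (huA : u ∈ A) (hvA : v ∈ A) :
    τ ⊆ cornerOrientation (G.deleteEdges {s(u, v)}) k τ A B := by
  rintro ⟨C, D⟩ hCD
  have hsAB := hτ.isSep hAB.mem
  have hAB' := isSep_iff.1 hsAB
  have hsG := isSep_iff.1 (hτ.isSep hCD)
  have hc := hτ.card_lt hCD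
  have hs : IsSep (G.deleteEdges {s(u, v)}) C D :=
    isSep_deleteEdge_iff.2 ⟨hsG.1, fun a b hab => Or.inr (Or.inr (hsG.2 a b hab))⟩
  refine ⟨hs, hc, ?_⟩
  by_cases hcorner : ((A ∪ C) ∩ (B ∩ D)).card < k
  · left
    refine hτ.mem_of_covers (isSep_corner huA hvA hsAB hs) hcorner hAB.mem hCD ?_
    unfold CoversG; grind
  · refine Or.inr ⟨?_, not_lt.1 hcorner⟩
    have hor := (hAB.card_corner_lt_or hk hτ hσ huA hvA hs hc).resolve_left hcorner
    refine hτ.mem_of_covers (isSep_corner huA hvA hsAB hs.symm).symm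
      (by rwa [inter_comm]) hCD hCD ?_
    unfold CoversG; grind

end Extremal

/-- If `τ` is a `k`-tangle (`k ≥ 2`) in `G` and there exists a `(k+1)`-tangle `τ̃` in `G` with
`τ ⊄ τ̃`, then there is an edge `e` of `G` such that `τ` extends to a `k`-tangle in `G - e`. -/
theorem stmt13 (k : ℕ) (hk : 2 ≤ k) (G : SimpleGraph V)
    (τ : Set (Finset V × Finset V)) (hτ : IsTangle G k τ)
    (τtilde : Set (Finset V × Finset V)) (hτtilde : IsTangle G (k + 1) τtilde)
    (hnsub : ¬ τ ⊆ τtilde) :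
    ∃ e ∈ G.edgeSet, ∃ τ' : Set (Finset V × Finset V),
      IsTangle (G.deleteEdges {e}) k τ' ∧ τ ⊆ τ' := by
  obtain ⟨A, B, hAB⟩ := exists_isExtremal hτ hτtilde hnsub
  obtain ⟨u, huA, v, hvA, huv⟩ := hAB.exists_adj hk hτ hτtilde
  exact ⟨s(u, v), huv, _, hAB.isTangle_cornerOrientation hk hτ hτtilde huA hvA,
    hAB.subset_cornerOrientation hk hτ hτtilde huA hvA⟩
end

section
/- Let n, m, p ≥ 1 be integers with p ≥ n^m. Then every sequence (a_1, …, a_p) of integers with a_i ∈ {0, …, m−1} for every i ∈ [p] has a subsequence (a_{i_1}, …, a_{i_n}) of length n (with i_1 < i_2 < … < i_n) such that (i) ℓ := a_{i_1} = … = a_{i_n}, and (ii) a_j ≥ ℓ for all indices j with i_1 ≤ j ≤ i_n. -/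
/-- If `f` takes values in `[l, l + k)` on an interval of length `n ^ k`, then some value `ℓ` is
attained at `n` points of this interval such that `f` is at least `ℓ` between any two of them. -/
theorem exists_strictMono_eq_and_le_between (n : ℕ) (f : ℕ → ℕ) (k l s : ℕ)
    (hf : ∀ i, s ≤ i → i < s + n ^ k → l ≤ f i ∧ f i < l + k) :
    ∃ ι : Fin n → ℕ, StrictMono ι ∧ (∀ x, s ≤ ι x ∧ ι x < s + n ^ k) ∧
      ∃ ℓ, (∀ x, f (ι x) = ℓ) ∧ ∀ x y j, ι x ≤ j → j ≤ ι y → ℓ ≤ f j := by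
  induction k generalizing l s with
  | zero =>
    have := hf s le_rfl (by simp)
    omega
  | succ k ih =>
    have block_le {b c : ℕ} (h : b < c) : b * n ^ k + n ^ k ≤ c * n ^ k := by
      rw [← Nat.succ_mul]
      exact Nat.mul_le_mul_right _ h
    have block_le_pow (b : Fin n) : b * n ^ k + n ^ k ≤ n ^ (k + 1) := by
      rw [pow_succ']
      exact block_le b.isLt
    by_cases h : ∀ b : Fin n, ∃ i, s + b * n ^ k ≤ i ∧ i < s + b * n ^ k + n ^ k ∧ f i = l
    · choose ι hlo hhi hl using h
      have hmem (x : Fin n) : s ≤ ι x ∧ ι x < s + n ^ (k + 1) := by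
        have := hlo x
        have := hhi x
        have := block_le_pow x
        omega
      refine ⟨ι, fun b c hbc => ?_, hmem, l, hl, fun x y j hx hy => ?_⟩
      · have := hhi b
        have := hlo c
        have := block_le (Fin.lt_def.mp hbc)
        omega
      · exact (hf j ((hmem x).1.trans hx) (hy.trans_lt (hmem y).2)).1
    · push Not at h
      obtain ⟨b, hb⟩ := h
      have hle := block_le_pow b
      obtain ⟨ι, hmono, hmem, hι⟩ := ih (l + 1) (s + b * n ^ k) fun i hlo hhi => by
        have := hf i (by omega) (by omega)
        have := hb i hlo hhi
        omega
      refine ⟨ι, hmono, fun x => ?_, hι⟩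
      have := hmem x
      omega


/-- Let `n, m, p ≥ 1` with `p ≥ n ^ m`.  Every sequence `(a_1, …, a_p)` of integers with
`a_i ∈ {0, …, m - 1}` has a subsequence `(a_{i_1}, …, a_{i_n})` of length `n` all of whose
entries are equal to some `ℓ`, such that `a_j ≥ ℓ` for all `i_1 ≤ j ≤ i_n`. -/
theorem stmt14 (n m p : ℕ) (hn : 1 ≤ n) (hm : 1 ≤ m) (hp : n ^ m ≤ p)
    (a : Fin p → ℕ) (ha : ∀ i, a i < m) :
    ∃ ι : Fin n → Fin p, StrictMono ι ∧
      ∃ ℓ : ℕ, (∀ j : Fin n, a (ι j) = ℓ) ∧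
        ∀ j : Fin p, ι ⟨0, hn⟩ ≤ j → j ≤ ι ⟨n - 1, Nat.sub_lt hn Nat.one_pos⟩ → ℓ ≤ a j := by
  obtain ⟨ι, hmono, hmem, ℓ, hℓ, hbetween⟩ := exists_strictMono_eq_and_le_between n
    (fun i => if h : i < p then a ⟨i, h⟩ else 0) m 0 0 fun i _ hi => by
      have hip : i < p := by omega
      simpa [hip] using ha ⟨i, hip⟩
  have hlt (x : Fin n) : ι x < p := by
    have := hmem x
    omega
  refine ⟨fun x => ⟨ι x, hlt x⟩, fun x y hxy => hmono hxy, ℓ, fun x => ?_, fun j h₁ h₂ => ?_⟩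
  · simpa [hlt x] using hℓ x
  · simpa using hbetween _ _ j h₁ h₂
end

section
/- Let G be a graph and n, m, p ≥ 1 be integers with p ≥ n^m. If there is a strictly increasing sequence of length p of oriented separations of G of order < m, then there is also a strictly increasing sequence ((A_i, B_i))_{i ∈ [n]} of length n of oriented separations of G of order < m such that (i) all orders are equal: ℓ := |A_1 ∩ B_1| = … = |A_n ∩ B_n|, and (ii) for every oriented separation (A,B) of G of order < ℓ there is no i ∈ [n−1] with (A_i, B_i) < (A, B) < (A_{i+1}, B_{i+1}). -/
/-- A finite chain can be enumerated in increasing order. -/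
theorem exists_strictMono_enumeration {α : Type*} [PartialOrder α] (T : Finset α)
    (hT : IsChain (· ≤ ·) (T : Set α)) :
    ∃ e : Fin T.card → α, StrictMono e ∧ (∀ i, e i ∈ T) ∧ ∀ t ∈ T, ∃ i, e i = t := by
  classical
  let _ : LinearOrder T :=
    { (inferInstance : PartialOrder T) with
      le_total := fun a b => hT.total a.2 b.2
      toDecidableLE := Classical.decRel _ }
  let φ : Fin T.card ≃o T := Fintype.orderIsoFinOfCardEq T (Fintype.card_coe T)
  refine ⟨fun i => (φ i : α), fun i j hij => φ.strictMono hij, fun i => (φ i).2,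
    fun t ht => ⟨φ.symm ⟨t, ht⟩, by simp⟩⟩

/-- In a finite chain `C`, more than `k * (|L| + 1)` elements outside a set `L` contain `k + 1`
elements such that no element of `C` lies strictly between two consecutive ones. -/
theorem exists_strictMono_of_mul_lt_card {α : Type*} [PartialOrder α] [DecidableEq α]
    (C L : Finset α) (hC : IsChain (· ≤ ·) (C : Set α)) (k : ℕ)
    (hcard : (L.card + 1) * k < (C \ L).card) :
    ∃ d : Fin (k + 1) → α, StrictMono d ∧ (∀ i, d i ∈ C \ L) ∧
      ∀ i j : Fin (k + 1), (j : ℕ) = i + 1 → ∀ c ∈ C, c ≤ d i ∨ d j ≤ c := by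
  classical
  obtain ⟨r, -, hr⟩ := Finset.exists_lt_card_fiber_of_mul_lt_card_of_maps_to
    (s := C \ L) (t := Finset.range (L.card + 1)) (f := fun x => (L.filter (· < x)).card)
    (fun x _ => Finset.mem_range.2 (Nat.lt_succ_of_le (Finset.card_filter_le _ _)))
    (by simpa using hcard)
  set T := {x ∈ C \ L | (L.filter (· < x)).card = r} with hTdef
  have hTC : T ⊆ C := (Finset.filter_subset _ _).trans Finset.sdiff_subset
  obtain ⟨e, he, heT, hsurj⟩ := exists_strictMono_enumeration T (hC.mono (by exact_mod_cast hTC))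
  refine ⟨fun i => e (Fin.castLE hr i), fun i j hij => he (by simpa using hij),
    fun i => (Finset.mem_filter.1 (heT _)).1, ?_⟩
  intro i j hij c hc
  set a := e (Fin.castLE hr i) with ha
  set b := e (Fin.castLE hr j) with hb
  have haT : a ∈ T := heT _
  have hbT : b ∈ T := heT _
  rcases hC.total hc (hTC haT) with h | h
  · exact Or.inl h
  rcases hC.total hc (hTC hbT) with h' | h'
  swap
  · exact Or.inr h'
  have hcT : c ∈ T := by
    rcases h'.eq_or_lt with rfl | hcb
    · exact hbT
    have har : (L.filter (· < a)).card = r := (Finset.mem_filter.1 haT).2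
    have hbr : (L.filter (· < b)).card = r := (Finset.mem_filter.1 hbT).2
    have hac : L.filter (· < a) ⊆ L.filter (· < c) :=
      Finset.monotone_filter_right _ fun y _ hy => lt_of_lt_of_le hy h
    have hcb' : L.filter (· < c) ⊆ L.filter (· < b) :=
      Finset.monotone_filter_right _ fun y _ hy => lt_of_lt_of_le hy h'
    have h1 := Finset.card_le_card hac
    have h2 := Finset.card_le_card hcb'
    have hcL : c ∉ L := by
      intro hcL
      have heq := Finset.eq_of_subset_of_card_le hcb' (by omega)
      have hmem : c ∈ L.filter (· < b) := Finset.mem_filter.2 ⟨hcL, hcb⟩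
      rw [← heq] at hmem
      exact lt_irrefl _ (Finset.mem_filter.1 hmem).2
    exact Finset.mem_filter.2 ⟨Finset.mem_sdiff.2 ⟨hc, hcL⟩, by omega⟩
  obtain ⟨t, rfl⟩ := hsurj c hcT
  rcases le_or_gt (t : ℕ) i with hti | hti
  · exact Or.inl (he.monotone (show t ≤ Fin.castLE hr i from hti))
  · refine Or.inr (he.monotone (show Fin.castLE hr j ≤ t from ?_))
    rw [Fin.le_def]
    simp only [Fin.val_castLE]
    omega

/-- A chain of length `n ^ m` of elements of rank `< m` yields a chain of length `n` of elements
of equal rank, with no element of smaller rank strictly between consecutive members. -/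
theorem exists_strictMono_rank_eq {α : Type*} [PartialOrder α] [Fintype α] (S : Set α)
    (f : α → ℕ) (n m : ℕ) (hn : 1 ≤ n) (C₀ : Finset α) (hC₀ : IsChain (· ≤ ·) (C₀ : Set α))
    (hS₀ : ∀ x ∈ C₀, x ∈ S ∧ f x < m) (hcard₀ : n ^ m ≤ C₀.card) :
    ∃ d : Fin n → α, StrictMono d ∧ (∀ i, d i ∈ S) ∧ ∃ ℓ < m, (∀ i, f (d i) = ℓ) ∧
      ∀ x ∈ S, f x < ℓ → ∀ i j : Fin n, (j : ℕ) = i + 1 → ¬ (d i < x ∧ x < d j) := by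
  classical
  obtain ⟨k, rfl⟩ : ∃ k, n = k + 1 := ⟨n - 1, by omega⟩
  let Q : ℕ → Finset α → Prop := fun l C =>
    IsChain (· ≤ ·) (C : Set α) ∧ (∀ x ∈ C, x ∈ S ∧ f x < l) ∧ (k + 1) ^ l ≤ C.card
  have hex : ∃ l, ∃ C, Q l C := ⟨m, C₀, hC₀, hS₀, hcard₀⟩
  have hlm : Nat.find hex ≤ m := Nat.find_min' hex ⟨C₀, hC₀, hS₀, hcard₀⟩
  have hspec := Nat.find_spec hex
  have hmin := fun l => @Nat.find_min _ _ hex l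
  generalize Nat.find hex = l at hlm hspec hmin
  cases l with
  | zero =>
    obtain ⟨C, -, h2, h3⟩ := hspec
    obtain ⟨x, hx⟩ := Finset.card_pos.1 (lt_of_lt_of_le (by simp) h3)
    exact absurd (h2 x hx).2 (by omega)
  | succ l =>
    obtain ⟨C, hC, hCmax⟩ := Finset.exists_max_image (Finset.univ.filter (Q (l + 1)))
      (fun C => (C.filter (f · < l)).card) (by
        obtain ⟨C, hC⟩ := hspec
        exact ⟨C, by simpa using hC⟩)
    obtain ⟨hchain, hCS, hcard⟩ : Q (l + 1) C := by simpa using hC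
    have hlow : (C.filter (f · < l)).card < (k + 1) ^ l := by
      by_contra! h
      refine hmin l (by omega) ⟨C.filter (f · < l),
        hchain.mono (by exact_mod_cast Finset.filter_subset _ _), fun x hx => ?_, h⟩
      rw [Finset.mem_filter] at hx
      exact ⟨(hCS x hx.1).1, hx.2⟩
    have hsum := Finset.card_sdiff_add_card_eq_card (Finset.filter_subset (f · < l) C)
    obtain ⟨d, hd, hdC, hcomp⟩ := exists_strictMono_of_mul_lt_card C (C.filter (f · < l)) hchain k (by
        have := Nat.mul_le_mul_right k hlow
        rw [pow_succ, mul_add, mul_one] at hcard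
        rw [Nat.succ_eq_add_one] at this
        omega)
    have hdC' : ∀ i, d i ∈ C ∧ f (d i) = l := fun i => by
      have h := hdC i
      simp only [Finset.mem_sdiff, Finset.mem_filter, not_and, not_lt] at h
      have h1 := h.2 h.1
      have h2 := (hCS _ h.1).2
      exact ⟨h.1, by omega⟩
    refine ⟨d, hd, fun i => (hCS _ (hdC' i).1).1, l, by omega, fun i => (hdC' i).2, ?_⟩
    rintro x hxS hxl i j hij ⟨hix, hxj⟩
    have hCx : ∀ c ∈ C, c < x ∨ x < c := fun c hc =>
      (hcomp i j hij c hc).imp (fun h => h.trans_lt hix) fun h => hxj.trans_le h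
    have hxC : x ∉ C := fun hxC => (hCx x hxC).elim (lt_irrefl x) (lt_irrefl x)
    have hQ : Q (l + 1) (insert x C) := by
      refine ⟨?_, ?_, hcard.trans (Finset.card_le_card (Finset.subset_insert _ _))⟩
      · rw [Finset.coe_insert]
        exact hchain.insert fun c hc _ => (hCx c hc).symm.imp le_of_lt le_of_lt
      · intro c hc
        rcases Finset.mem_insert.1 hc with rfl | hc
        · exact ⟨hxS, by omega⟩
        · exact hCS c hc
    have hle := hCmax (insert x C) (by simpa using hQ)
    rw [Finset.filter_insert, if_pos hxl, Finset.card_insert_of_notMem (by simp [hxC])] at hle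
    omega


open Finset

variable {V : Type} [Fintype V] [DecidableEq V]

/-- The natural partial order on oriented separations: `(A, B) ≤ (C, D)` iff `A ⊆ C` and
`D ⊆ B`. -/
def SepLE (p q : Finset V × Finset V) : Prop :=
  p.1 ⊆ q.1 ∧ q.2 ⊆ p.2

/-- The strict version of the partial order on oriented separations. -/
def SepLT (p q : Finset V × Finset V) : Prop :=
  SepLE p q ∧ p ≠ q

/-- Let `n, m, p ≥ 1` with `p ≥ n ^ m`.  If a graph `G` has a strictly increasing sequence of
length `p` of oriented separations of order `< m`, then it also has a strictly increasing
sequence of length `n` of oriented separations, all of the same order `ℓ < m`, such that no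
separation of order `< ℓ` lies strictly between two consecutive members of the sequence. -/
theorem stmt15 (G : SimpleGraph V) (n m p : ℕ) (hn : 1 ≤ n) (hm : 1 ≤ m) (hp : n ^ m ≤ p)
    (c : Fin p → Finset V × Finset V)
    (hcsep : ∀ i, IsSep G (c i).1 (c i).2 ∧ ((c i).1 ∩ (c i).2).card < m)
    (hcmono : ∀ i j : Fin p, i < j → SepLT (c i) (c j)) :
    ∃ d : Fin n → Finset V × Finset V,
      (∀ i, IsSep G (d i).1 (d i).2 ∧ ((d i).1 ∩ (d i).2).card < m) ∧
      (∀ i j : Fin n, i < j → SepLT (d i) (d j)) ∧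
      ∃ ℓ : ℕ, (∀ i, ((d i).1 ∩ (d i).2).card = ℓ) ∧
        ∀ A B : Finset V, IsSep G A B → (A ∩ B).card < ℓ →
          ∀ i j : Fin n, (j : ℕ) = (i : ℕ) + 1 →
            ¬ (SepLT (d i) (A, B) ∧ SepLT (A, B) (d j)) := by
  let φ : Finset V × Finset V → Finset V × (Finset V)ᵒᵈ := fun p => (p.1, OrderDual.toDual p.2)
  have hφ : ∀ p q, SepLT p q ↔ φ p < φ q := fun p q => by
    rw [lt_iff_le_and_ne]
    refine and_congr Iff.rfl (not_congr ?_)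
    simp [φ, Prod.ext_iff]
  have hc : StrictMono (φ ∘ c) := fun i j hij => (hφ _ _).1 (hcmono i j hij)
  obtain ⟨d, hd, hdS, ℓ, hℓ, hdℓ, hbetween⟩ := exists_strictMono_rank_eq
    {x : Finset V × (Finset V)ᵒᵈ | IsSep G x.1 (OrderDual.ofDual x.2)}
    (fun x => (x.1 ∩ OrderDual.ofDual x.2).card) n m hn (Finset.univ.image (φ ∘ c))
    (by
      rw [Finset.coe_image, Finset.coe_univ, Set.image_univ]
      exact hc.monotone.isChain_range)
    (fun x hx => by
      obtain ⟨i, -, rfl⟩ := Finset.mem_image.1 hx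
      exact hcsep i)
    (by rwa [Finset.card_image_of_injective _ hc.injective, Finset.card_univ, Fintype.card_fin])
  refine ⟨fun i => ((d i).1, OrderDual.ofDual (d i).2),
    fun i => ⟨hdS i, (hdℓ i).trans_lt hℓ⟩, fun i j hij => (hφ _ _).2 (hd hij), ℓ, hdℓ, ?_⟩
  intro A B hAB hlt i j hij h
  exact hbetween (φ (A, B)) hAB hlt i j hij ⟨(hφ _ _).1 h.1, (hφ _ _).1 h.2⟩
end
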